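/- Let n ≥ 1 and let c, d : ℤⁿ → ℝ be square-summable families (Σ_{k∈ℤⁿ} (c_k² + d_k²) < ∞). For t > 0 define f_t : ℝⁿ → ℝ by f_t(x) = Σ_{k∈ℤⁿ} e^{−|k|² t} (c_k cos(k·x) + d_k sin(k·x)). Set h₀ = c_0 (the constant term) and h₁(x) = Σ_{k∈ℤⁿ, |k|²=1} (c_k cos(k·x) + d_k sin(k·x)). Then for every multi-index α (i.e. every finite sequence of coordinate directions i₁,…,i_s), the iterated partial derivative of e^{t}(f_t − h₀) − h₁ converges to 0 uniformly on ℝⁿ as t → ∞; in particular, for every r ≥ 0, the C^r norm of e^{t}(f_t − h₀) − h₁ tends to 0 as t → ∞. -/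

import Mathlib

/-- Iterated partial derivative in the directions given by a list of coordinates:
`iterPartial [i₁, …, i_s] g = ∂^s g / ∂x_{i_s} ⋯ ∂x_{i_1}` (differentiating with respect
to the head of the list first). -/
noncomputable def iterPartial {n : ℕ} : List (Fin n) → ((Fin n → ℝ) → ℝ) → ((Fin n → ℝ) → ℝ)
  | [], g => g
  | i :: l, g => iterPartial l fun x => fderiv ℝ g x (Pi.single i 1)

/-- The squared Euclidean length `|k|²` of a lattice vector. -/
noncomputable def latticeSq {n : ℕ} (k : Fin n → ℤ) : ℝ := ∑ i, (k i : ℝ) ^ 2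

/-- The linear form `x ↦ k·x`. -/
noncomputable def phase {n : ℕ} (k : Fin n → ℤ) : (Fin n → ℝ) →L[ℝ] ℝ :=
  ∑ i, (k i : ℝ) • ContinuousLinearMap.proj i

/-- The trigonometric series with coefficients `(a, b)`. -/
noncomputable def trigSum {n : ℕ} (a b : (Fin n → ℤ) → ℝ) (x : Fin n → ℝ) : ℝ :=
  ∑' k, (a k * Real.cos (phase k x) + b k * Real.sin (phase k x))

/-- The coefficients `(a, b)` decay faster than every polynomial. -/
def RapidDecay {n : ℕ} (a b : (Fin n → ℤ) → ℝ) : Prop :=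
  ∀ s : ℕ, Summable fun k => (1 + latticeSq k) ^ s * (|a k| + |b k|)

section Lattice

variable {n : ℕ}

theorem latticeSq_nonneg (k : Fin n → ℤ) : 0 ≤ latticeSq k :=
  Finset.sum_nonneg fun _ _ => sq_nonneg _

theorem latticeSq_eq_cast (k : Fin n → ℤ) : latticeSq k = ((∑ i, k i ^ 2 : ℤ) : ℝ) := by
  simp [latticeSq]

theorem phase_apply (k : Fin n → ℤ) (x : Fin n → ℝ) : phase k x = ∑ i, (k i : ℝ) * x i := by
  simp [phase]

theorem phase_single (k : Fin n → ℤ) (i : Fin n) : phase k (Pi.single i 1) = k i := by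
  simp [phase_apply, Pi.single_apply]

theorem abs_intCast_le_sq (m : ℤ) : |(m : ℝ)| ≤ (m : ℝ) ^ 2 := by
  have h := Int.natAbs_le_self_sq m
  rw [Int.natCast_natAbs] at h
  exact_mod_cast h

theorem abs_coord_le_latticeSq (k : Fin n → ℤ) (i : Fin n) : |(k i : ℝ)| ≤ latticeSq k :=
  (abs_intCast_le_sq _).trans
    (Finset.single_le_sum (f := fun i => (k i : ℝ) ^ 2) (fun _ _ => sq_nonneg _)
      (Finset.mem_univ i))

theorem norm_phase_le (k : Fin n → ℤ) : ‖phase k‖ ≤ latticeSq k := by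
  refine ContinuousLinearMap.opNorm_le_bound _ (latticeSq_nonneg k) fun x => ?_
  rw [phase_apply, latticeSq, Finset.sum_mul]
  refine (norm_sum_le _ _).trans (Finset.sum_le_sum fun i _ => ?_)
  rw [norm_mul]
  exact mul_le_mul (abs_intCast_le_sq _) (norm_le_pi_norm x i) (norm_nonneg _) (sq_nonneg _)

theorem summable_pi_prod {g : ℤ → ℝ} (hg : Summable g) (hg0 : 0 ≤ g) (n : ℕ) :
    Summable fun k : Fin n → ℤ => ∏ i, g (k i) := by
  induction n with
  | zero => exact Summable.of_finite
  | succ n ih =>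
    rw [← (Fin.consEquiv fun _ => ℤ).summable_iff]
    refine (hg.mul_of_nonneg ih hg0 fun k => Finset.prod_nonneg fun i _ => hg0 _).congr ?_
    intro p
    simp [Fin.prod_univ_succ, Fin.consEquiv]

theorem summable_exp_neg_abs_int {r : ℝ} (hr : 0 < r) :
    Summable fun m : ℤ => Real.exp (-r * |(m : ℝ)|) := by
  have h : Summable fun m : ℕ => Real.exp (-r * (m : ℝ)) := by
    simpa [mul_comm] using Real.summable_exp_nat_mul_iff.mpr (neg_neg_of_pos hr)
  refine Summable.of_nat_of_neg ?_ ?_ <;> simpa using h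

theorem summable_exp_neg_latticeSq {r : ℝ} (hr : 0 < r) :
    Summable fun k : Fin n → ℤ => Real.exp (-r * latticeSq k) := by
  refine Summable.of_nonneg_of_le (fun _ => (Real.exp_pos _).le) (fun k => ?_)
    (summable_pi_prod (summable_exp_neg_abs_int hr) (fun _ => (Real.exp_pos _).le) n)
  rw [← Real.exp_sum, latticeSq, Finset.mul_sum]
  refine Real.exp_le_exp.mpr (Finset.sum_le_sum fun i _ => ?_)
  nlinarith [abs_intCast_le_sq (k i)]

theorem summable_pow_mul_exp_neg_latticeSq (s : ℕ) :
    Summable fun k : Fin n → ℤ => (1 + latticeSq k) ^ s * Real.exp (-latticeSq k) := by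
  refine Summable.of_nonneg_of_le
    (fun k => mul_nonneg (pow_nonneg (by linarith [latticeSq_nonneg k]) _) (Real.exp_pos _).le)
    (fun k => ?_)
    ((summable_exp_neg_latticeSq (n := n) (r := 1 / 2) (by norm_num)).mul_left
      (2 ^ s * s.factorial * Real.exp (1 / 2)))
  have hq := latticeSq_nonneg k
  have h := Real.pow_div_factorial_le_exp (x := (1 + latticeSq k) / 2) (by linarith) s
  rw [div_pow, div_div, div_le_iff₀ (by positivity)] at h
  calc (1 + latticeSq k) ^ s * Real.exp (-latticeSq k)
      ≤ Real.exp ((1 + latticeSq k) / 2) * (2 ^ s * s.factorial) * Real.exp (-latticeSq k) := by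
        gcongr
    _ = 2 ^ s * s.factorial * (Real.exp ((1 + latticeSq k) / 2) * Real.exp (-latticeSq k)) := by
        ring
    _ = 2 ^ s * s.factorial * Real.exp (1 / 2) * Real.exp (-(1 / 2) * latticeSq k) := by
        rw [mul_assoc _ (Real.exp (1 / 2)), ← Real.exp_add, ← Real.exp_add]
        ring_nf

end Lattice

section TrigSum

variable {n : ℕ} {a b : (Fin n → ℤ) → ℝ}

theorem abs_mul_cos_add_mul_sin_le (u v θ : ℝ) :
    |u * Real.cos θ + v * Real.sin θ| ≤ |u| + |v| := by
  refine (abs_add_le _ _).trans (add_le_add ?_ ?_) <;> rw [abs_mul]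
  · exact mul_le_of_le_one_right (abs_nonneg _) (Real.abs_cos_le_one θ)
  · exact mul_le_of_le_one_right (abs_nonneg _) (Real.abs_sin_le_one θ)

theorem RapidDecay.summable (h : RapidDecay a b) : Summable fun k => |a k| + |b k| := by
  simpa using h 0

theorem RapidDecay.summable_trig (h : RapidDecay a b) (x : Fin n → ℝ) :
    Summable fun k => a k * Real.cos (phase k x) + b k * Real.sin (phase k x) :=
  Summable.of_norm_bounded h.summable fun _ => abs_mul_cos_add_mul_sin_le _ _ _

theorem abs_coord_mul_add_le (a b : (Fin n → ℤ) → ℝ) (i : Fin n) (k : Fin n → ℤ) :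
    |k i * b k| + |-(k i * a k)| ≤ (1 + latticeSq k) * (|a k| + |b k|) := by
  rw [abs_neg, abs_mul, abs_mul, ← mul_add, add_comm |b k|]
  gcongr
  linarith [abs_coord_le_latticeSq k i]

theorem RapidDecay.coord_mul (h : RapidDecay a b) (i : Fin n) :
    RapidDecay (fun k => k i * b k) fun k => -(k i * a k) := by
  intro s
  have hq : ∀ k : Fin n → ℤ, 0 ≤ 1 + latticeSq k := fun k => by linarith [latticeSq_nonneg k]
  refine Summable.of_nonneg_of_le
    (fun k => mul_nonneg (pow_nonneg (hq k) s) (by positivity)) (fun k => ?_) (h (s + 1))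
  rw [pow_succ, mul_assoc]
  exact mul_le_mul_of_nonneg_left (abs_coord_mul_add_le a b i k) (pow_nonneg (hq k) s)

theorem RapidDecay.fderiv_trigSum_single (h : RapidDecay a b) (x : Fin n → ℝ) (i : Fin n) :
    fderiv ℝ (trigSum a b) x (Pi.single i 1) =
      trigSum (fun k => k i * b k) (fun k => -(k i * a k)) x := by
  have hd : ∀ (k : Fin n → ℤ) (y : Fin n → ℝ),
      HasFDerivAt (fun y => a k * Real.cos (phase k y) + b k * Real.sin (phase k y))
        ((b k * Real.cos (phase k y) + -a k * Real.sin (phase k y)) • phase k) y := by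
    intro k y
    have hp := (phase k).hasFDerivAt (x := y)
    refine ((hp.cos.const_mul (a k)).add (hp.sin.const_mul (b k))).congr_fderiv ?_
    ext v
    simp
    ring
  have hb : ∀ (k : Fin n → ℤ) (y : Fin n → ℝ),
      ‖(b k * Real.cos (phase k y) + -a k * Real.sin (phase k y)) • phase k‖ ≤
        (1 + latticeSq k) ^ 1 * (|a k| + |b k|) := by
    intro k y
    rw [norm_smul, pow_one, mul_comm]
    have h1 := abs_mul_cos_add_mul_sin_le (b k) (-a k) (phase k y)
    rw [abs_neg, add_comm |b k|] at h1
    exact mul_le_mul (by linarith [norm_phase_le k]) h1 (norm_nonneg _)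
      (by linarith [latticeSq_nonneg k])
  have hS := Summable.of_norm_bounded (h 1) fun k => hb k x
  have hD : HasFDerivAt (trigSum a b) _ x :=
    hasFDerivAt_tsum (h 1) hd hb (h.summable_trig x) x
  rw [hD.fderiv]
  refine ((ContinuousLinearMap.apply ℝ ℝ (Pi.single i (1 : ℝ))).map_tsum hS).trans
    (tsum_congr fun k => ?_)
  simp only [ContinuousLinearMap.apply_apply, smul_apply, phase_single, smul_eq_mul]
  ring

theorem RapidDecay.abs_iterPartial_trigSum_le (h : RapidDecay a b) (l : List (Fin n))
    (x : Fin n → ℝ) :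
    |iterPartial l (trigSum a b) x| ≤
      ∑' k, (1 + latticeSq k) ^ l.length * (|a k| + |b k|) := by
  induction l generalizing a b with
  | nil =>
    simp only [iterPartial, List.length_nil, pow_zero, one_mul]
    have hk : ∀ k, ‖a k * Real.cos (phase k x) + b k * Real.sin (phase k x)‖ ≤ |a k| + |b k| :=
      fun k => abs_mul_cos_add_mul_sin_le _ _ _
    exact tsum_of_norm_bounded h.summable.hasSum hk
  | cons i l ih =>
    rw [iterPartial, funext fun y => h.fderiv_trigSum_single y i]
    refine (ih (h.coord_mul i)).trans (Summable.tsum_le_tsum (fun k => ?_) (h.coord_mul i _) (h _))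
    rw [List.length_cons, pow_succ, mul_assoc]
    exact mul_le_mul_of_nonneg_left (abs_coord_mul_add_le a b i k)
      (pow_nonneg (by linarith [latticeSq_nonneg k]) _)

theorem rapidDecay_of_abs_le_exp {A : ℝ} (ha : ∀ k, |a k| ≤ A * Real.exp (-latticeSq k))
    (hb : ∀ k, |b k| ≤ A * Real.exp (-latticeSq k)) : RapidDecay a b := by
  intro s
  have hq : ∀ k : Fin n → ℤ, 0 ≤ 1 + latticeSq k := fun k => by linarith [latticeSq_nonneg k]
  refine Summable.of_nonneg_of_le
    (fun k => mul_nonneg (pow_nonneg (hq k) s) (by positivity)) (fun k => ?_)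
    ((summable_pow_mul_exp_neg_latticeSq (n := n) s).mul_left (2 * A))
  calc (1 + latticeSq k) ^ s * (|a k| + |b k|)
      ≤ (1 + latticeSq k) ^ s * (2 * A * Real.exp (-latticeSq k)) :=
        mul_le_mul_of_nonneg_left (by linarith [ha k, hb k]) (pow_nonneg (hq k) s)
    _ = 2 * A * ((1 + latticeSq k) ^ s * Real.exp (-latticeSq k)) := by ring

theorem abs_iterPartial_trigSum_le_of_abs_le_exp {A : ℝ}
    (ha : ∀ k, |a k| ≤ A * Real.exp (-latticeSq k))
    (hb : ∀ k, |b k| ≤ A * Real.exp (-latticeSq k)) (l : List (Fin n)) (x : Fin n → ℝ) :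
    |iterPartial l (trigSum a b) x| ≤
      A * (2 * ∑' k : Fin n → ℤ, (1 + latticeSq k) ^ l.length * Real.exp (-latticeSq k)) := by
  have h := rapidDecay_of_abs_le_exp ha hb
  refine (h.abs_iterPartial_trigSum_le l x).trans ?_
  rw [← mul_assoc, ← tsum_mul_left]
  refine Summable.tsum_le_tsum (fun k => ?_) (h _)
    ((summable_pow_mul_exp_neg_latticeSq l.length).mul_left _)
  calc (1 + latticeSq k) ^ l.length * (|a k| + |b k|)
      ≤ (1 + latticeSq k) ^ l.length * (2 * A * Real.exp (-latticeSq k)) :=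
        mul_le_mul_of_nonneg_left (by linarith [ha k, hb k])
          (pow_nonneg (by linarith [latticeSq_nonneg k]) _)
    _ = A * 2 * ((1 + latticeSq k) ^ l.length * Real.exp (-latticeSq k)) := by ring

end TrigSum

section HeatRemainder

variable {n : ℕ}

/-- The Fourier multiplier of the rescaled heat flow with the modes `|k|² ≤ 1` removed. -/
noncomputable def remainderWeight (t : ℝ) (k : Fin n → ℤ) : ℝ :=
  if latticeSq k ≤ 1 then 0 else Real.exp (t * (1 - latticeSq k))

theorem eq_zero_or_latticeSq (k : Fin n → ℤ) : k = 0 ∨ latticeSq k = 1 ∨ 2 ≤ latticeSq k := by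
  rw [latticeSq_eq_cast]
  have h0 : 0 ≤ ∑ i, k i ^ 2 := Finset.sum_nonneg fun _ _ => sq_nonneg _
  by_cases hz : ∑ i, k i ^ 2 = 0
  · left
    ext i
    have := (Finset.sum_eq_zero_iff_of_nonneg fun i _ => sq_nonneg (k i)).mp hz i
      (Finset.mem_univ i)
    simpa using this
  · right
    have : ∑ i, k i ^ 2 = 1 ∨ 2 ≤ ∑ i, k i ^ 2 := by omega
    exact_mod_cast this

theorem latticeSq_zero : latticeSq (0 : Fin n → ℤ) = 0 := by
  simp [latticeSq]

theorem abs_remainderWeight_le {t : ℝ} (ht : 1 ≤ t) (k : Fin n → ℤ) :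
    |remainderWeight t k| ≤ Real.exp (2 - t) * Real.exp (-latticeSq k) := by
  rw [remainderWeight]
  split_ifs with h
  · rw [abs_zero]
    positivity
  · have h2 : 2 ≤ latticeSq k := by
      rcases eq_zero_or_latticeSq k with rfl | h' | h'
      · exact absurd (latticeSq_zero.trans_le zero_le_one) h
      · exact absurd h'.le h
      · exact h'
    rw [Real.abs_exp, ← Real.exp_add]
    exact Real.exp_le_exp.mpr (by nlinarith)

theorem abs_remainderWeight_mul_le {t M u : ℝ} (ht : 1 ≤ t) (hu : |u| ≤ M) (k : Fin n → ℤ) :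
    |remainderWeight t k * u| ≤ Real.exp (2 - t) * M * Real.exp (-latticeSq k) := by
  rw [abs_mul, mul_right_comm]
  exact mul_le_mul (abs_remainderWeight_le ht k) hu (abs_nonneg _) (by positivity)

theorem remainderWeight_eq (t : ℝ) (k : Fin n → ℤ) :
    remainderWeight t k = Real.exp t * (Real.exp (-latticeSq k * t) - if k = 0 then 1 else 0) -
      if ∑ i, k i ^ 2 = (1 : ℤ) then 1 else 0 := by
  have hiff : ∑ i, k i ^ 2 = (1 : ℤ) ↔ latticeSq k = 1 := by
    rw [latticeSq_eq_cast]
    norm_cast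
  simp only [hiff, remainderWeight]
  rcases eq_zero_or_latticeSq k with rfl | h | h
  · simp [latticeSq_zero]
  · have hk : k ≠ 0 := by
      rintro rfl
      simp [latticeSq_zero] at h
    simp [h, hk, ← Real.exp_add]
  · have hk : k ≠ 0 := by
      rintro rfl
      rw [latticeSq_zero] at h
      norm_num at h
    rw [if_neg (by linarith), if_neg hk, if_neg (by linarith), sub_zero, sub_zero, ← Real.exp_add]
    ring_nf

theorem trigSum_remainder_eq {c d : (Fin n → ℤ) → ℝ} {M : ℝ} (hc : ∀ k, |c k| ≤ M)
    (hd : ∀ k, |d k| ≤ M) {t : ℝ} (ht : 1 ≤ t) (x : Fin n → ℝ) :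
    Real.exp t * ((∑' k, Real.exp (-latticeSq k * t) *
        (c k * Real.cos (phase k x) + d k * Real.sin (phase k x))) - c 0) -
      (∑' k, if ∑ i, k i ^ 2 = (1 : ℤ) then
        c k * Real.cos (phase k x) + d k * Real.sin (phase k x) else 0) =
    trigSum (fun k => remainderWeight t k * c k) (fun k => remainderWeight t k * d k) x := by
  set m : (Fin n → ℤ) → ℝ := fun k => c k * Real.cos (phase k x) + d k * Real.sin (phase k x)
    with hm
  have hmM : ∀ k, |m k| ≤ M + M := fun k =>
    (abs_mul_cos_add_mul_sin_le _ _ _).trans (add_le_add (hc k) (hd k))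
  have hexp : Summable fun k : Fin n → ℤ => Real.exp (-latticeSq k) := by
    simpa using summable_pow_mul_exp_neg_latticeSq (n := n) 0
  have hF : Summable fun k => Real.exp (-latticeSq k * t) * m k := by
    refine Summable.of_norm_bounded (hexp.mul_right (M + M)) fun k => ?_
    rw [norm_mul, Real.norm_eq_abs, Real.abs_exp]
    refine mul_le_mul (Real.exp_le_exp.mpr ?_) (hmM k) (norm_nonneg _) (Real.exp_pos _).le
    nlinarith [latticeSq_nonneg k]
  have hR : Summable fun k => remainderWeight t k * m k :=
    Summable.of_norm_bounded (hexp.mul_left (Real.exp (2 - t) * (M + M))) fun k =>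
      abs_remainderWeight_mul_le ht (hmM k) k
  have hG : HasSum (fun k => if k = 0 then m k else 0) (c 0) := by
    convert hasSum_ite_eq (0 : Fin n → ℤ) (c 0) using 2 with k
    split_ifs with h
    · simp [hm, h, phase_apply]
    · rfl
  have hL := (hF.hasSum.sub hG).mul_left (Real.exp t)
  have hsplit : ∀ k, (if ∑ i, k i ^ 2 = (1 : ℤ) then m k else 0) =
      Real.exp t * (Real.exp (-latticeSq k * t) * m k - if k = 0 then m k else 0) -
        remainderWeight t k * m k := by
    intro k
    rw [remainderWeight_eq]
    split_ifs <;> ring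
  have hH := (hL.sub hR.hasSum).congr_fun hsplit
  rw [hH.tsum_eq, sub_sub_cancel, trigSum]
  refine tsum_congr fun k => ?_
  simp only [hm]
  ring

end HeatRemainder

theorem exists_abs_le_of_summable_sq {ι : Type*} {c d : ι → ℝ}
    (h : Summable fun k => c k ^ 2 + d k ^ 2) :
    ∃ M, (∀ k, |c k| ≤ M) ∧ ∀ k, |d k| ≤ M := by
  have hle : ∀ k, c k ^ 2 + d k ^ 2 ≤ ∑' j, (c j ^ 2 + d j ^ 2) := fun k =>
    h.le_tsum k fun j _ => by positivity
  refine ⟨√(∑' j, (c j ^ 2 + d j ^ 2)), fun k => ?_, fun k => ?_⟩ <;>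
    refine Real.abs_le_sqrt ?_ <;> nlinarith [hle k, sq_nonneg (c k), sq_nonneg (d k)]

/-- For square-summable Fourier data `(c, d)` on `ℤⁿ`, with heat flow
`f t x = ∑' k, exp (-|k|² t) (c k cos (k·x) + d k sin (k·x))`, constant term `h₀ = c 0`,
and first mode `h₁ x = ∑' {k : |k|² = 1}, (c k cos (k·x) + d k sin (k·x))`, every
iterated partial derivative of `exp t * (f t - h₀) - h₁` tends to `0` uniformly on `ℝⁿ`
as `t → ∞`. -/
theorem stmt_4 (n : ℕ) (hn : 1 ≤ n) (c d : (Fin n → ℤ) → ℝ)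
    (hsq : Summable fun k : Fin n → ℤ => c k ^ 2 + d k ^ 2)
    (f : ℝ → (Fin n → ℝ) → ℝ)
    (hf : ∀ (t : ℝ) (x : Fin n → ℝ), f t x =
      ∑' k : Fin n → ℤ,
        Real.exp (-(∑ i, ((k i : ℝ)) ^ 2) * t) *
          (c k * Real.cos (∑ i, (k i : ℝ) * x i) + d k * Real.sin (∑ i, (k i : ℝ) * x i)))
    (h₀ : ℝ) (hh₀ : h₀ = c 0)
    (h₁ : (Fin n → ℝ) → ℝ)
    (hh₁ : ∀ x : Fin n → ℝ, h₁ x =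
      ∑' k : Fin n → ℤ,
        if (∑ i, (k i) ^ 2) = (1 : ℤ) then
          c k * Real.cos (∑ i, (k i : ℝ) * x i) + d k * Real.sin (∑ i, (k i : ℝ) * x i)
        else 0) :
    ∀ l : List (Fin n),
      TendstoUniformly
        (fun (t : ℝ) (x : Fin n → ℝ) =>
          iterPartial l (fun y => Real.exp t * (f t y - h₀) - h₁ y) x)
        (fun _ => 0) Filter.atTop := by
  intro l
  obtain ⟨M, hc, hd⟩ := exists_abs_le_of_summable_sq hsq
  set C : ℝ := M * (2 * ∑' k : Fin n → ℤ, (1 + latticeSq k) ^ l.length * Real.exp (-latticeSq k))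
  have hlim : Filter.Tendsto (fun t : ℝ => Real.exp (2 - t) * C) Filter.atTop (nhds 0) := by
    have h : Filter.Tendsto (fun t : ℝ => 2 - t) Filter.atTop Filter.atBot :=
      Filter.tendsto_atBot_add_const_left _ 2 Filter.tendsto_neg_atTop_atBot
    simpa using (Real.tendsto_exp_atBot.comp h).mul_const C
  rw [Metric.tendstoUniformly_iff]
  intro ε hε
  filter_upwards [hlim.eventually_lt_const hε, Filter.eventually_ge_atTop 1] with t hlt ht x
  have heq : (fun y => Real.exp t * (f t y - h₀) - h₁ y) =
      trigSum (fun k => remainderWeight t k * c k) fun k => remainderWeight t k * d k := by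
    funext y
    rw [← trigSum_remainder_eq hc hd ht y, hf, hh₀, hh₁]
    simp only [phase_apply, latticeSq]
  rw [dist_zero_left, heq, Real.norm_eq_abs]
  refine (abs_iterPartial_trigSum_le_of_abs_le_exp
    (fun k => abs_remainderWeight_mul_le ht (hc k) k)
    (fun k => abs_remainderWeight_mul_le ht (hd k) k) l x).trans_lt ?_
  rwa [mul_assoc]
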